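/- Let C and B be weakly dual Hopf algebras over a field k with pairing ev, σ a right 2-cocycle on B, and τ a left 2-cocycle on C. Then the right twist of the product of Drin_k(C,B) by the 2-cocycle σ∘τ, namely x·_{σ∘τ}y := x₍₁₎y₍₁₎ (σ∘τ)(x₍₂₎⊗y₍₂₎) (Sweedler components with respect to the Drinfeld double coproduct, product in Drin_k(C,B)), is given explicitly by (b⊗c)·_{σ∘τ}(b'⊗c') = (b·_σ b'₍₂₎) ⊗ (c₍₁₎·_τ c') · ev(c₍₂₎, b'₍₁₎), where b·_σ b' := b₍₁₎b'₍₁₎σ(b₍₂₎⊗b'₍₂₎) and c·_τ c' := c₍₂₎c'₍₂₎τ(c₍₁₎⊗c'₍₁₎). In particular, this product on the vector space B⊗C is associative with unit 1⊗1. -/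

import Mathlib

/-!
STATEMENT 15: For weakly dual Hopf algebras `C`, `B`, a right 2-cocycle `σ` on `B` and a
left 2-cocycle `τ` on `C`, the right twist of the Drinfeld double product by `σ∘τ` is
given explicitly by `(b⊗c)·(b'⊗c') = (b ·σ b'₍₂₎) ⊗ (c₍₁₎ ·τ c') · ev(c₍₂₎, b'₍₁₎)`;
in particular this product on `B ⊗ C` is associative with unit `1 ⊗ 1`.
-/

open scoped TensorProduct

noncomputable section

variable {k B C : Type} [Field k] [Ring B] [HopfAlgebra k B] [Ring C] [HopfAlgebra k C]

/-- `ev : C × B → k` is a weak Hopf algebra pairing. -/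
def IsWeakHopfPairing (ev : C →ₗ[k] B →ₗ[k] k) : Prop :=
  (∀ (c c' : C) (b : B) (n : ℕ) (b1 b2 : Fin n → B),
    Coalgebra.comul (R := k) b = ∑ i, b1 i ⊗ₜ[k] b2 i →
    ev (c * c') b = ∑ i, ev c (b2 i) * ev c' (b1 i)) ∧
  (∀ (c : C) (b b' : B) (m : ℕ) (c1 c2 : Fin m → C),
    Coalgebra.comul (R := k) c = ∑ j, c1 j ⊗ₜ[k] c2 j →
    ev c (b * b') = ∑ j, ev (c1 j) b' * ev (c2 j) b) ∧
  (∀ b : B, ev 1 b = Coalgebra.counit (R := k) b) ∧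
  (∀ c : C, ev c 1 = Coalgebra.counit (R := k) c) ∧
  (∀ (c : C) (b : B),
    ev (HopfAlgebra.antipode (R := k) c) b = ev c (HopfAlgebra.antipode (R := k) b))

/-- The coproduct of the Drinfeld double: `Δ(b⊗c) = (b₍₁₎⊗c₍₂₎) ⊗ (b₍₂₎⊗c₍₁₎)`. -/
def DrinComul (k B C : Type) [Field k] [Ring B] [HopfAlgebra k B] [Ring C]
    [HopfAlgebra k C] : B ⊗[k] C →ₗ[k] (B ⊗[k] C) ⊗[k] (B ⊗[k] C) :=
  (TensorProduct.tensorTensorTensorComm k B B C C).toLinearMap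
    ∘ₗ TensorProduct.map (Coalgebra.comul (R := k))
        ((TensorProduct.comm k C C).toLinearMap ∘ₗ Coalgebra.comul (R := k))

/-- `mD` is the product of the Drinfeld double `Drin_k(C,B)`:
`(b⊗c)(b'⊗c') = b b'₍₂₎ ⊗ c₍₂₎c' · ev(c₍₁₎, S(b'₍₃₎)) · ev(c₍₃₎, b'₍₁₎)`. -/
def IsDrinMul (ev : C →ₗ[k] B →ₗ[k] k)
    (mD : (B ⊗[k] C) ⊗[k] (B ⊗[k] C) →ₗ[k] B ⊗[k] C) : Prop :=
  ∀ (b : B) (c : C) (b' : B) (c' : C)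
    (n : ℕ) (p1 p2 : Fin n → B) (q : Fin n → ℕ) (pp1 pp2 : (i : Fin n) → Fin (q i) → B)
    (m : ℕ) (r1 r2 : Fin m → C) (s : Fin m → ℕ) (rr1 rr2 : (j : Fin m) → Fin (s j) → C),
    Coalgebra.comul (R := k) b' = ∑ i, p1 i ⊗ₜ[k] p2 i →
    (∀ i, Coalgebra.comul (R := k) (p2 i) = ∑ i', pp1 i i' ⊗ₜ[k] pp2 i i') →
    Coalgebra.comul (R := k) c = ∑ j, r1 j ⊗ₜ[k] r2 j →
    (∀ j, Coalgebra.comul (R := k) (r2 j) = ∑ j', rr1 j j' ⊗ₜ[k] rr2 j j') →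
    mD ((b ⊗ₜ[k] c) ⊗ₜ[k] (b' ⊗ₜ[k] c'))
      = ∑ i, ∑ i', ∑ j, ∑ j',
          (ev (r1 j) (HopfAlgebra.antipode (R := k) (pp2 i i')) * ev (rr2 j j') (p1 i))
            • ((b * pp1 i i') ⊗ₜ[k] (rr1 j j' * c'))


/-- comatrix coalgebra family -/
structure IsComat (k : Type) {A : Type} [Field k] [AddCommGroup A] [Module k A] [Coalgebra k A]
    {n : ℕ} (t : Fin n → Fin n → A) : Prop where
  comul : ∀ i j, Coalgebra.comul (R := k) (t i j) = ∑ l, t i l ⊗ₜ[k] t l j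
  counit : ∀ i j, Coalgebra.counit (R := k) (t i j) = if i = j then (1 : k) else 0

section
variable {k A : Type} [Field k] [AddCommGroup A] [Module k A] 

lemma exists_fin_rep (z : A ⊗[k] A) : ∃ n : ℕ, ∃ x y : Fin n → A, z = ∑ i, x i ⊗ₜ[k] y i := by
  induction z using TensorProduct.induction_on with
  | zero => exact ⟨0, Fin.elim0, Fin.elim0, by simp⟩
  | tmul a b => exact ⟨1, fun _ => a, fun _ => b, by simp⟩
  | add a b ha hb =>
    obtain ⟨n, x, y, rfl⟩ := ha
    obtain ⟨m, x', y', rfl⟩ := hb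
    exact ⟨n + m, Fin.append x x', Fin.append y y', by simp [Fin.sum_univ_add]⟩

lemma exists_fin_rep_indep (z : A ⊗[k] A) : ∃ n : ℕ, ∃ x y : Fin n → A,
    z = ∑ i, x i ⊗ₜ[k] y i ∧ LinearIndependent k x ∧ LinearIndependent k y := by
  classical
  have H := exists_fin_rep z
  obtain ⟨x, y, h⟩ := Nat.find_spec H
  have hmin := fun m (hm : m < Nat.find H) => Nat.find_min H hm
  generalize Nat.find H = n at *
  refine ⟨n, x, y, h, ?_, ?_⟩
  · by_contra hx
    rw [Fintype.linearIndependent_iff] at hx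
    push Not at hx
    obtain ⟨g, hg, i, hi⟩ := hx
    cases n with
    | zero => exact i.elim0
    | succ n =>
      refine hmin n (Nat.lt_succ_self n) ⟨fun j => x (i.succAbove j),
        fun j => y (i.succAbove j) - ((g i)⁻¹ * g (i.succAbove j)) • y i, ?_⟩
      have h1 : x i = - ∑ j, ((g i)⁻¹ * g (i.succAbove j)) • x (i.succAbove j) := by
        rw [Fin.sum_univ_succAbove _ i] at hg
        have := congrArg (fun v => (g i)⁻¹ • v) hg
        simp only [smul_add, smul_smul, inv_mul_cancel₀ hi, one_smul, smul_zero,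
          Finset.smul_sum] at this
        exact eq_neg_of_add_eq_zero_left this
      rw [h, Fin.sum_univ_succAbove _ i, h1]
      simp only [TensorProduct.tmul_sub, Finset.sum_sub_distrib, TensorProduct.neg_tmul,
        TensorProduct.sum_tmul, TensorProduct.tmul_smul, TensorProduct.smul_tmul']
      abel
  · by_contra hy
    rw [Fintype.linearIndependent_iff] at hy
    push Not at hy
    obtain ⟨g, hg, i, hi⟩ := hy
    cases n with
    | zero => exact i.elim0
    | succ n =>
      refine hmin n (Nat.lt_succ_self n)
        ⟨fun j => x (i.succAbove j) - ((g i)⁻¹ * g (i.succAbove j)) • x i,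
          fun j => y (i.succAbove j), ?_⟩
      have h1 : y i = - ∑ j, ((g i)⁻¹ * g (i.succAbove j)) • y (i.succAbove j) := by
        rw [Fin.sum_univ_succAbove _ i] at hg
        have := congrArg (fun v => (g i)⁻¹ • v) hg
        simp only [smul_add, smul_smul, inv_mul_cancel₀ hi, one_smul, smul_zero,
          Finset.smul_sum] at this
        exact eq_neg_of_add_eq_zero_left this
      rw [h, Fin.sum_univ_succAbove _ i, h1]
      simp only [TensorProduct.sub_tmul, Finset.sum_sub_distrib, TensorProduct.tmul_neg,
        TensorProduct.tmul_sum, TensorProduct.tmul_smul, TensorProduct.smul_tmul']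
      abel

lemma exists_dual_family {n : ℕ} {x : Fin n → A} (hx : LinearIndependent k x) :
    ∃ f : Fin n → (A →ₗ[k] k), ∀ i j, f i (x j) = if i = j then 1 else 0 := by
  classical
  obtain ⟨g, hg⟩ := hx.repr.exists_extend
  refine ⟨fun i => Finsupp.lapply i ∘ₗ g, fun i j => ?_⟩
  have := LinearMap.congr_fun hg ⟨x j, Submodule.subset_span ⟨j, rfl⟩⟩
  simp only [LinearMap.comp_apply, Submodule.subtype_apply] at this
  simp only [LinearMap.comp_apply, this]
  have h2 : hx.repr ⟨x j, Submodule.subset_span ⟨j, rfl⟩⟩ = Finsupp.single j 1 :=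
    hx.repr_eq_single j _ rfl
  simp [h2, Finsupp.single_apply, eq_comm]

lemma tmul_family_inj {M : Type} [AddCommGroup M] [Module k M] {n : ℕ} {y : Fin n → A}
    (hy : LinearIndependent k y)
    {u v : Fin n → M} (h : ∑ i, u i ⊗ₜ[k] y i = ∑ i, v i ⊗ₜ[k] y i) : u = v := by
  obtain ⟨f, hf⟩ := exists_dual_family hy
  funext i
  have := congrArg (fun z => TensorProduct.rid k M (TensorProduct.map LinearMap.id (f i) z)) h
  simpa [hf] using this

variable [Coalgebra k A]

open Coalgebra in
lemma exists_comat (b : A) : ∃ (n : ℕ) (t : Fin n → Fin n → A) (a : Fin n → Fin n → k),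
    IsComat k t ∧ b = ∑ i, ∑ j, a i j • t i j := by
  classical
  obtain ⟨n, x, e, hb, hx, he⟩ := exists_fin_rep_indep (comul (R := k) b)
  obtain ⟨f, hf⟩ := exists_dual_family hx
  set t : Fin n → Fin n → A := fun i j =>
    TensorProduct.lid k A (TensorProduct.map (f i) LinearMap.id (comul (R := k) (x j))) with ht
  have hco := Coalgebra.coassoc_apply (R := k) b
  rw [hb] at hco
  simp only [map_sum, LinearMap.rTensor_tmul, LinearMap.lTensor_tmul] at hco
  have hΔe : ∀ i, comul (R := k) (e i) = ∑ j, t i j ⊗ₜ[k] e j := by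
    intro i
    have h1 := congrArg (fun z => TensorProduct.lid k (A ⊗[k] A)
      (TensorProduct.map (f i) LinearMap.id z)) hco
    simp only [map_sum, TensorProduct.map_tmul, hf, LinearMap.id_apply, TensorProduct.lid_tmul,
      ite_smul, one_smul, zero_smul, Finset.sum_ite_eq, Finset.mem_univ, if_true] at h1
    rw [← h1]
    refine Finset.sum_congr rfl fun j _ => ?_
    simp only [ht]
    generalize comul (R := k) (x j) = z
    induction z using TensorProduct.induction_on with
    | zero => simp
    | tmul p q => simp [TensorProduct.smul_tmul']
    | add p q hp hq => simp only [TensorProduct.add_tmul, map_add, hp, hq]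
  have hcm : IsComat k t := by
    constructor
    · intro i j
      have h1 := Coalgebra.coassoc_apply (R := k) (e i)
      rw [hΔe] at h1
      simp only [map_sum, LinearMap.rTensor_tmul, LinearMap.lTensor_tmul, hΔe,
        TensorProduct.tmul_sum] at h1
      have h2 := congrArg (TensorProduct.assoc k A A A).symm h1
      simp only [map_sum, LinearEquiv.symm_apply_apply, TensorProduct.assoc_symm_tmul] at h2
      rw [Finset.sum_comm] at h2
      simp only [← TensorProduct.sum_tmul] at h2
      exact congrFun (tmul_family_inj he h2) j
    · intro i j
      have h1 := Coalgebra.rTensor_counit_comul (R := k) (e i)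
      rw [hΔe] at h1
      simp only [map_sum, LinearMap.rTensor_tmul] at h1
      have h2 : ∑ j, counit (R := k) (t i j) ⊗ₜ[k] e j
          = ∑ j, (if i = j then (1 : k) else 0) ⊗ₜ[k] e j := by
        rw [h1]
        rw [Finset.sum_eq_single i] <;> simp +contextual [eq_comm]
      exact congrFun (tmul_family_inj he h2) j
  refine ⟨n, t, fun i j => counit (R := k) (x i) * counit (R := k) (e j), hcm, ?_⟩
  have h1 := congrArg (TensorProduct.lid k A) (Coalgebra.rTensor_counit_comul (R := k) b)
  rw [hb] at h1
  simp only [map_sum, LinearMap.rTensor_tmul, TensorProduct.lid_tmul, one_smul] at h1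
  rw [← h1]
  refine Finset.sum_congr rfl fun i _ => ?_
  have h2 := congrArg (TensorProduct.rid k A) (Coalgebra.lTensor_counit_comul (R := k) (e i))
  rw [hΔe] at h2
  simp only [map_sum, LinearMap.lTensor_tmul, TensorProduct.rid_tmul, one_smul] at h2
  rw [← h2, Finset.smul_sum]
  simp [smul_smul]

/-- Two linear maps agreeing on comatrix entries agree. -/
lemma comat_ext {M : Type} [AddCommGroup M] [Module k M] (f g : A →ₗ[k] M)
    (h : ∀ (n : ℕ) (t : Fin n → Fin n → A), IsComat k t → ∀ i j, f (t i j) = g (t i j))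
    (b : A) : f b = g b := by
  obtain ⟨n, t, a, ht, rfl⟩ := exists_comat (k := k) b
  simp only [map_sum, map_smul, h n t ht]

end

@[elab_as_elim]
lemma comat_induction {k A : Type} [Field k] [AddCommGroup A] [Module k A] [Coalgebra k A]
    {P : A → Prop} (b : A)
    (h : ∀ (n : ℕ) (t : Fin n → Fin n → A), IsComat k t → ∀ i j, P (t i j))
    (hadd : ∀ x y, P x → P y → P (x + y)) (hsmul : ∀ (a : k) x, P x → P (a • x)) (h0 : P 0) :
    P b := by
  obtain ⟨n, t, a, ht, rfl⟩ := exists_comat (k := k) b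
  refine Finset.sum_induction _ P hadd h0 fun i _ => ?_
  exact Finset.sum_induction _ P hadd h0 fun j _ => hsmul _ _ (h n t ht i j)

section
variable {k B C : Type} [Field k] [Ring B] [HopfAlgebra k B] [Ring C] [HopfAlgebra k C]

/-- the explicit product, in terms of coproducts of the inner variables -/
def explG (ev : C →ₗ[k] B →ₗ[k] k) (mσ : B ⊗[k] B →ₗ[k] B) (mτ : C ⊗[k] C →ₗ[k] C)
    (b : B) (c' : C) : (B ⊗[k] B) ⊗[k] (C ⊗[k] C) →ₗ[k] B ⊗[k] C :=
  (TensorProduct.lid k (B ⊗[k] C)).toLinearMap ∘ₗ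
    TensorProduct.map (TensorProduct.lift ev.flip)
      (TensorProduct.map (mσ ∘ₗ TensorProduct.mk k B B b)
        (mτ ∘ₗ (TensorProduct.mk k C C).flip c')) ∘ₗ
    (TensorProduct.tensorTensorTensorComm k B B C C).toLinearMap ∘ₗ
    TensorProduct.map LinearMap.id (TensorProduct.comm k C C).toLinearMap

lemma explG_tmul (ev : C →ₗ[k] B →ₗ[k] k) (mσ : B ⊗[k] B →ₗ[k] B) (mτ : C ⊗[k] C →ₗ[k] C)
    (b p1 p2 : B) (r1 r2 c' : C) :
    explG ev mσ mτ b c' ((p1 ⊗ₜ[k] p2) ⊗ₜ[k] (r1 ⊗ₜ[k] r2))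
      = ev r2 p1 • (mσ (b ⊗ₜ[k] p2) ⊗ₜ[k] mτ (r1 ⊗ₜ[k] c')) := by
  simp [explG]

lemma ev_contract (ev : C →ₗ[k] B →ₗ[k] k) (hev : IsWeakHopfPairing ev)
    {n m : ℕ} {β : Fin n → Fin n → B} {γ : Fin m → Fin m → C}
    (hβ : IsComat k β) (hγ : IsComat k γ) (f a : Fin n) (d g : Fin m) :
    ∑ z, ∑ y, ev (γ d y) (β z a) * ev (γ y g) (HopfAlgebra.antipode (R := k) (β f z))
      = if f = a then (if d = g then 1 else 0) else 0 := by
  obtain ⟨-, h2, -, h4, -⟩ := hev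
  have h : ∀ z, ∑ y, ev (γ d y) (β z a) * ev (γ y g) (HopfAlgebra.antipode (R := k) (β f z))
      = ev (γ d g) (HopfAlgebra.antipode (R := k) (β f z) * β z a) := fun z =>
    (h2 (γ d g) _ _ m _ _ (hγ.comul d g)).symm
  simp only [h]
  rw [← map_sum]
  have h3 := HopfAlgebra.mul_antipode_rTensor_comul_apply (R := k) (β f a)
  rw [hβ.comul] at h3
  simp only [map_sum, LinearMap.rTensor_tmul, LinearMap.mul'_apply] at h3
  rw [h3, hβ.counit]
  split_ifs with h h'
  · rw [map_one, h4, hγ.counit, if_pos h']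
  · rw [map_one, h4, hγ.counit, if_neg h']
  · simp

lemma drinComul_comat {n m : ℕ} {β : Fin n → Fin n → B} {γ : Fin m → Fin m → C}
    (hβ : IsComat k β) (hγ : IsComat k γ) (i j : Fin n) (p q : Fin m) :
    DrinComul k B C (β i j ⊗ₜ[k] γ p q)
      = ∑ s : Fin n × Fin m, (β i s.1 ⊗ₜ[k] γ s.2 q) ⊗ₜ[k] (β s.1 j ⊗ₜ[k] γ p s.2) := by
  rw [Fintype.sum_prod_type, Finset.sum_comm]
  simp [DrinComul, hβ.comul, hγ.comul, TensorProduct.sum_tmul, TensorProduct.tmul_sum]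

lemma formula_comat
    (ev : C →ₗ[k] B →ₗ[k] k) (hev : IsWeakHopfPairing ev)
    (mD : (B ⊗[k] C) ⊗[k] (B ⊗[k] C) →ₗ[k] B ⊗[k] C) (hmD : IsDrinMul ev mD)
    (σ : B ⊗[k] B →ₗ[k] k) (τ : C ⊗[k] C →ₗ[k] k)
    (st : (B ⊗[k] C) ⊗[k] (B ⊗[k] C) →ₗ[k] k)
    (hst : ∀ (b : B) (c : C) (b' : B) (c' : C)
        (n : ℕ) (p1 p2 : Fin n → B) (m : ℕ) (r1 r2 : Fin m → C),
      Coalgebra.comul (R := k) b' = ∑ i, p1 i ⊗ₜ[k] p2 i →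
      Coalgebra.comul (R := k) c = ∑ j, r1 j ⊗ₜ[k] r2 j →
      st ((b ⊗ₜ[k] c) ⊗ₜ[k] (b' ⊗ₜ[k] c'))
        = ∑ i, ∑ j, σ (b ⊗ₜ[k] p2 i) * τ (r1 j ⊗ₜ[k] c') * ev (r2 j) (p1 i))
    (mT : (B ⊗[k] C) ⊗[k] (B ⊗[k] C) →ₗ[k] B ⊗[k] C)
    (hmT : ∀ (x y : B ⊗[k] C) (n m : ℕ)
        (x1 x2 : Fin n → B ⊗[k] C) (y1 y2 : Fin m → B ⊗[k] C),
      DrinComul k B C x = ∑ i, x1 i ⊗ₜ[k] x2 i →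
      DrinComul k B C y = ∑ j, y1 j ⊗ₜ[k] y2 j →
      mT (x ⊗ₜ[k] y) = ∑ i, ∑ j, st (x2 i ⊗ₜ[k] y2 j) • mD (x1 i ⊗ₜ[k] y1 j))
    (mσ : B ⊗[k] B →ₗ[k] B)
    (hmσ : ∀ (g h : B) (n m : ℕ) (g1 g2 : Fin n → B) (h1 h2 : Fin m → B),
      Coalgebra.comul (R := k) g = ∑ i, g1 i ⊗ₜ[k] g2 i →
      Coalgebra.comul (R := k) h = ∑ j, h1 j ⊗ₜ[k] h2 j →
      mσ (g ⊗ₜ[k] h) = ∑ i, ∑ j, σ (g2 i ⊗ₜ[k] h2 j) • (g1 i * h1 j))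
    (mτ : C ⊗[k] C →ₗ[k] C)
    (hmτ : ∀ (g h : C) (n m : ℕ) (g1 g2 : Fin n → C) (h1 h2 : Fin m → C),
      Coalgebra.comul (R := k) g = ∑ i, g1 i ⊗ₜ[k] g2 i →
      Coalgebra.comul (R := k) h = ∑ j, h1 j ⊗ₜ[k] h2 j →
      mτ (g ⊗ₜ[k] h) = ∑ i, ∑ j, τ (g1 i ⊗ₜ[k] h1 j) • (g2 i * h2 j))
    {n1 n2 m1 m2 : ℕ} {β : Fin n1 → Fin n1 → B} {γ : Fin m1 → Fin m1 → C}
    {β' : Fin n2 → Fin n2 → B} {γ' : Fin m2 → Fin m2 → C}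
    (hβ : IsComat k β) (hγ : IsComat k γ) (hβ' : IsComat k β') (hγ' : IsComat k γ')
    (i j : Fin n1) (κ l : Fin m1) (p q : Fin n2) (r s : Fin m2) :
    mT ((β i j ⊗ₜ[k] γ κ l) ⊗ₜ[k] (β' p q ⊗ₜ[k] γ' r s))
      = ∑ e, ∑ h, ev (γ h l) (β' p e) •
          (mσ (β i j ⊗ₜ[k] β' e q) ⊗ₜ[k] mτ (γ κ h ⊗ₜ[k] γ' r s)) := by
  -- the double coproduct, indexed by arbitrary finite types
  have hmT' : mT ((β i j ⊗ₜ[k] γ κ l) ⊗ₜ[k] (β' p q ⊗ₜ[k] γ' r s))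
      = ∑ u : Fin n1 × Fin m1, ∑ v : Fin n2 × Fin m2,
        st ((β u.1 j ⊗ₜ[k] γ κ u.2) ⊗ₜ[k] (β' v.1 q ⊗ₜ[k] γ' r v.2)) •
          mD ((β i u.1 ⊗ₜ[k] γ u.2 l) ⊗ₜ[k] (β' p v.1 ⊗ₜ[k] γ' v.2 s)) := by
    have hx := drinComul_comat hβ hγ i j κ l
    have hy := drinComul_comat hβ' hγ' p q r s
    let e1 := (Fintype.equivFin (Fin n1 × Fin m1)).symm
    let e2 := (Fintype.equivFin (Fin n2 × Fin m2)).symm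
    rw [← e1.sum_comp] at hx
    rw [← e2.sum_comp] at hy
    rw [hmT _ _ _ _ _ _ _ _ hx hy, ← e1.sum_comp]
    refine Finset.sum_congr rfl fun u _ => ?_
    rw [← e2.sum_comp]
  have hD : ∀ x y z w, mD ((β i x ⊗ₜ[k] γ y l) ⊗ₜ[k] (β' p z ⊗ₜ[k] γ' w s))
      = ∑ e, ∑ f, ∑ g, ∑ h, (ev (γ y g) (HopfAlgebra.antipode (R := k) (β' f z)) *
          ev (γ h l) (β' p e)) • ((β i x * β' e f) ⊗ₜ[k] (γ g h * γ' w s)) := fun x y z w =>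
    hmD _ _ _ _ n2 _ _ (fun _ => n2) (fun e f => β' e f) (fun e f => β' f z) m1 _ _ (fun _ => m1)
      (fun g h => γ g h) (fun g h => γ h l) (hβ'.comul p z) (fun e => hβ'.comul e z)
      (hγ.comul y l) (fun g => hγ.comul g l)
  have hS : ∀ x y z w, st ((β x j ⊗ₜ[k] γ κ y) ⊗ₜ[k] (β' z q ⊗ₜ[k] γ' r w))
      = ∑ a, ∑ d, σ (β x j ⊗ₜ[k] β' a q) * τ (γ κ d ⊗ₜ[k] γ' r w) * ev (γ d y) (β' z a) :=
    fun x y z w => hst _ _ _ _ _ _ _ _ _ _ (hβ'.comul z q) (hγ.comul κ y)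
  have hL : mT ((β i j ⊗ₜ[k] γ κ l) ⊗ₜ[k] (β' p q ⊗ₜ[k] γ' r s))
      = ∑ x, ∑ w, ∑ a, ∑ d, ∑ e, ∑ f, ∑ g, ∑ h,
        (∑ z, ∑ y, ev (γ d y) (β' z a) * ev (γ y g) (HopfAlgebra.antipode (R := k) (β' f z))) •
        (σ (β x j ⊗ₜ[k] β' a q) * τ (γ κ d ⊗ₜ[k] γ' r w) * ev (γ h l) (β' p e)) •
          ((β i x * β' e f) ⊗ₜ[k] (γ g h * γ' w s)) := by
    rw [hmT']
    simp only [hD, hS]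
    simp only [Finset.sum_smul, Finset.smul_sum]
    simp only [smul_smul, ← Fintype.sum_prod_type']
    refine Fintype.sum_equiv ⟨fun ⟨⟨x, y⟩, ⟨z, w⟩, e, f, g, h, a, d⟩ =>
        (x, w, a, d, e, f, g, h, z, y), fun ⟨x, w, a, d, e, f, g, h, z, y⟩ =>
        ((x, y), (z, w), e, f, g, h, a, d), fun _ => rfl, fun _ => rfl⟩ _ _ ?_
    rintro ⟨⟨x, y⟩, ⟨z, w⟩, e, f, g, h, a, d⟩
    dsimp only [Equiv.coe_fn_mk]
    congr 1
    ring
  rw [hL]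
  simp only [ev_contract ev hev hβ' hγ, hmσ _ _ _ _ _ _ _ _ (hβ.comul _ _) (hβ'.comul _ _),
    hmτ _ _ _ _ _ _ _ _ (hγ.comul _ _) (hγ'.comul _ _)]
  simp only [ite_smul, one_smul, zero_smul, Finset.sum_ite_irrel, Finset.sum_const_zero,
    Finset.sum_ite_eq, Finset.sum_ite_eq', Finset.mem_univ, if_true]
  simp only [TensorProduct.sum_tmul, TensorProduct.tmul_sum, Finset.smul_sum]
  simp only [TensorProduct.tmul_smul, ← TensorProduct.smul_tmul', smul_smul]
  simp only [← Fintype.sum_prod_type']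
  refine Fintype.sum_equiv ⟨fun ⟨x, w, f, g, e, h⟩ => (e, h, g, w, x, f),
    fun ⟨e, h, g, w, x, f⟩ => (x, w, f, g, e, h), fun _ => rfl, fun _ => rfl⟩ _ _ ?_
  rintro ⟨x, w, f, g, e, h⟩
  dsimp only [Equiv.coe_fn_mk]
  congr 1
  ring

end

section
variable {k B C : Type} [Field k] [Ring B] [HopfAlgebra k B] [Ring C] [HopfAlgebra k C]

lemma reindex2 {A M : Type} [AddCommGroup A] [Module k A] [AddCommMonoid M]
    (X Y : A ⊗[k] A) (F : A → A → A → A → M) (w : M)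
    (H : ∀ (n m : ℕ) (g1 g2 : Fin n → A) (h1 h2 : Fin m → A),
      X = ∑ i, g1 i ⊗ₜ[k] g2 i → Y = ∑ j, h1 j ⊗ₜ[k] h2 j →
      w = ∑ i, ∑ j, F (g1 i) (g2 i) (h1 j) (h2 j))
    (ι κ : Type) [Fintype ι] [Fintype κ] {g1 g2 : ι → A} {h1 h2 : κ → A}
    (hX : X = ∑ i, g1 i ⊗ₜ[k] g2 i) (hY : Y = ∑ j, h1 j ⊗ₜ[k] h2 j) :
    w = ∑ i, ∑ j, F (g1 i) (g2 i) (h1 j) (h2 j) := by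
  let e1 := (Fintype.equivFin ι).symm
  let e2 := (Fintype.equivFin κ).symm
  rw [← e1.sum_comp] at hX
  rw [← e2.sum_comp] at hY
  rw [H _ _ _ _ _ _ hX hY, ← e1.sum_comp]
  refine Finset.sum_congr rfl fun u _ => ?_
  rw [← e2.sum_comp]

lemma comul_comat_mul {n1 n2 : ℕ} {t1 : Fin n1 → Fin n1 → B} {t2 : Fin n2 → Fin n2 → B}
    (h1 : IsComat k t1) (h2 : IsComat k t2) (i j : Fin n1) (p q : Fin n2) :
    Coalgebra.comul (R := k) (t1 i j * t2 p q)
      = ∑ u, ∑ v, (t1 i u * t2 p v) ⊗ₜ[k] (t1 u j * t2 v q) := by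
  rw [Bialgebra.comul_mul, h1.comul, h2.comul, Finset.sum_mul_sum]
  simp only [Algebra.TensorProduct.tmul_mul_tmul]

lemma comul_comat_mul' {n1 n2 : ℕ} {t1 : Fin n1 → Fin n1 → B} {t2 : Fin n2 → Fin n2 → B}
    (h1 : IsComat k t1) (h2 : IsComat k t2) (i j : Fin n1) (p q : Fin n2) :
    Coalgebra.comul (R := k) (t1 i j * t2 p q)
      = ∑ u : Fin n1 × Fin n2, (t1 i u.1 * t2 p u.2) ⊗ₜ[k] (t1 u.1 j * t2 u.2 q) := by
  rw [comul_comat_mul h1 h2, Fintype.sum_prod_type]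

lemma comul_mσ
    (σ : B ⊗[k] B →ₗ[k] k) (mσ : B ⊗[k] B →ₗ[k] B)
    (hmσ : ∀ (g h : B) (n m : ℕ) (g1 g2 : Fin n → B) (h1 h2 : Fin m → B),
      Coalgebra.comul (R := k) g = ∑ i, g1 i ⊗ₜ[k] g2 i →
      Coalgebra.comul (R := k) h = ∑ j, h1 j ⊗ₜ[k] h2 j →
      mσ (g ⊗ₜ[k] h) = ∑ i, ∑ j, σ (g2 i ⊗ₜ[k] h2 j) • (g1 i * h1 j))
    {n1 n2 : ℕ} {t1 : Fin n1 → Fin n1 → B} {t2 : Fin n2 → Fin n2 → B}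
    (h1 : IsComat k t1) (h2 : IsComat k t2) (i j : Fin n1) (κ l : Fin n2) :
    Coalgebra.comul (R := k) (mσ (t1 i j ⊗ₜ[k] t2 κ l))
      = ∑ x, ∑ y, (t1 i x * t2 κ y) ⊗ₜ[k] mσ (t1 x j ⊗ₜ[k] t2 y l) := by
  simp only [hmσ _ _ _ _ _ _ _ _ (h1.comul _ _) (h2.comul _ _), map_sum, map_smul,
    comul_comat_mul h1 h2, TensorProduct.tmul_sum, TensorProduct.sum_tmul, Finset.smul_sum,
    TensorProduct.tmul_smul, ← TensorProduct.smul_tmul']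
  simp only [← Fintype.sum_prod_type']
  refine Fintype.sum_equiv ⟨fun ⟨x, y, u, v⟩ => (u, v, x, y),
    fun ⟨u, v, x, y⟩ => (x, y, u, v), fun _ => rfl, fun _ => rfl⟩ _ _ ?_
  rintro ⟨x, y, u, v⟩
  rfl

lemma assoc_mσ
    (σ : B ⊗[k] B →ₗ[k] k) (mσ : B ⊗[k] B →ₗ[k] B)
    (hmσ : ∀ (g h : B) (n m : ℕ) (g1 g2 : Fin n → B) (h1 h2 : Fin m → B),
      Coalgebra.comul (R := k) g = ∑ i, g1 i ⊗ₜ[k] g2 i →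
      Coalgebra.comul (R := k) h = ∑ j, h1 j ⊗ₜ[k] h2 j →
      mσ (g ⊗ₜ[k] h) = ∑ i, ∑ j, σ (g2 i ⊗ₜ[k] h2 j) • (g1 i * h1 j))
    (hco : ∀ (h g l : B) (m p : ℕ) (g1 g2 : Fin m → B) (l1 l2 : Fin p → B),
      Coalgebra.comul (R := k) g = ∑ j, g1 j ⊗ₜ[k] g2 j →
      Coalgebra.comul (R := k) l = ∑ s, l1 s ⊗ₜ[k] l2 s →
      ∀ (n : ℕ) (h1 h2 : Fin n → B),
      Coalgebra.comul (R := k) h = ∑ i, h1 i ⊗ₜ[k] h2 i →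
      ∑ j, ∑ s, σ (h ⊗ₜ[k] (g1 j * l1 s)) * σ (g2 j ⊗ₜ[k] l2 s)
        = ∑ i, ∑ j, σ ((h1 i * g1 j) ⊗ₜ[k] l) * σ (h2 i ⊗ₜ[k] g2 j))
    (a b c : B) :
    mσ (mσ (a ⊗ₜ[k] b) ⊗ₜ[k] c) = mσ (a ⊗ₜ[k] mσ (b ⊗ₜ[k] c)) := by
  refine comat_induction (k := k) a (fun n1 t1 h1 i j => ?_) ?_ ?_ ?_
  rotate_left
  · intro x y hx hy; simp only [TensorProduct.add_tmul, map_add, hx, hy]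
  · intro s x hx; simp only [← TensorProduct.smul_tmul', map_smul, hx]
  · simp
  refine comat_induction (k := k) b (fun n2 t2 h2 κ l => ?_) ?_ ?_ ?_
  rotate_left
  · intro x y hx hy; simp only [TensorProduct.add_tmul, TensorProduct.tmul_add, map_add, hx, hy]
  · intro s x hx
    simp only [← TensorProduct.smul_tmul', TensorProduct.tmul_smul, map_smul, hx]
  · simp
  refine comat_induction (k := k) c (fun n3 t3 h3 p q => ?_) ?_ ?_ ?_
  rotate_left
  · intro x y hx hy; simp only [TensorProduct.tmul_add, map_add, hx, hy]
  · intro s x hx; simp only [TensorProduct.tmul_smul, map_smul, hx]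
  · simp
  have e1 : ∀ x y x' y', mσ ((t1 x x' * t2 y y') ⊗ₜ[k] t3 p q) = _ := fun x y x' y' =>
    reindex2 _ _ (fun g1 g2 h1 h2 => σ (g2 ⊗ₜ[k] h2) • (g1 * h1)) _
      (hmσ (t1 x x' * t2 y y') (t3 p q)) _ _
      (comul_comat_mul' h1 h2 x x' y y') (h3.comul p q)
  have e2 : ∀ x y x' y', mσ (t1 i j ⊗ₜ[k] (t2 x x' * t3 y y')) = _ := fun x y x' y' =>
    reindex2 _ _ (fun g1 g2 h1 h2 => σ (g2 ⊗ₜ[k] h2) • (g1 * h1)) _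
      (hmσ (t1 i j) (t2 x x' * t3 y y')) _ _
      (h1.comul i j) (comul_comat_mul' h2 h3 x x' y y')
  have hL : mσ (mσ (t1 i j ⊗ₜ[k] t2 κ l) ⊗ₜ[k] t3 p q) = ∑ u, ∑ v, ∑ r,
      (∑ x, ∑ y, σ ((t1 u x * t2 v y) ⊗ₜ[k] t3 r q) * σ (t1 x j ⊗ₜ[k] t2 y l)) • (t1 i u * t2 κ v * t3 p r) := by
    rw [hmσ _ _ _ _ _ _ _ _ (h1.comul i j) (h2.comul κ l)]
    simp only [TensorProduct.sum_tmul, ← TensorProduct.smul_tmul', map_sum, map_smul, e1]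
    simp only [Finset.sum_smul, Finset.smul_sum]
    simp only [smul_smul, ← Fintype.sum_prod_type']
    refine Fintype.sum_equiv ⟨fun ⟨x, y, ⟨u, v⟩, r⟩ => (u, v, r, x, y),
      fun ⟨u, v, r, x, y⟩ => (x, y, (u, v), r), fun _ => rfl, fun _ => rfl⟩ _ _ ?_
    rintro ⟨x, y, ⟨u, v⟩, r⟩
    dsimp only [Equiv.coe_fn_mk]
    congr 1
    ring
  rw [hL, hmσ _ _ _ _ _ _ _ _ (h2.comul κ l) (h3.comul p q)]
  have hc := fun u v r => hco (t1 u j) (t2 v l) (t3 r q) _ _ _ _ _ _ (h2.comul _ _) (h3.comul _ _) _ _ _ (h1.comul _ _)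
  simp only [← hc, TensorProduct.tmul_sum, TensorProduct.tmul_smul, map_sum, map_smul, e2]
  simp only [Finset.sum_smul, Finset.smul_sum]
  simp only [smul_smul, ← Fintype.sum_prod_type', mul_assoc]
  refine Fintype.sum_equiv ⟨fun ⟨u, v, r, x, y⟩ => (x, y, u, (v, r)),
    fun ⟨x, y, u, (v, r)⟩ => (u, v, r, x, y), fun _ => rfl, fun _ => rfl⟩ _ _ ?_
  rintro ⟨u, v, r, x, y⟩
  dsimp only [Equiv.coe_fn_mk]
  congr 1
  ring

lemma mσ_one
    (σ : B ⊗[k] B →ₗ[k] k) (mσ : B ⊗[k] B →ₗ[k] B)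
    (hmσ : ∀ (g h : B) (n m : ℕ) (g1 g2 : Fin n → B) (h1 h2 : Fin m → B),
      Coalgebra.comul (R := k) g = ∑ i, g1 i ⊗ₜ[k] g2 i →
      Coalgebra.comul (R := k) h = ∑ j, h1 j ⊗ₜ[k] h2 j →
      mσ (g ⊗ₜ[k] h) = ∑ i, ∑ j, σ (g2 i ⊗ₜ[k] h2 j) • (g1 i * h1 j))
    (hX : ∀ h : B, σ (h ⊗ₜ[k] (1 : B)) = Coalgebra.counit (R := k) h) (a : B) :
    mσ (a ⊗ₜ[k] 1) = a := by
  refine comat_induction (k := k) a (fun n1 t1 h1 i j => ?_) ?_ ?_ ?_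
  · rw [hmσ _ _ _ 1 _ _ (fun _ => 1) (fun _ => 1) (h1.comul i j)
      (by simp [Algebra.TensorProduct.one_def])]
    simp [hX, h1.counit]
  · intro x y hx hy; simp only [TensorProduct.add_tmul, map_add, hx, hy]
  · intro s x hx; simp only [← TensorProduct.smul_tmul', map_smul, hx]
  · simp

lemma one_mσ
    (σ : B ⊗[k] B →ₗ[k] k) (mσ : B ⊗[k] B →ₗ[k] B)
    (hmσ : ∀ (g h : B) (n m : ℕ) (g1 g2 : Fin n → B) (h1 h2 : Fin m → B),
      Coalgebra.comul (R := k) g = ∑ i, g1 i ⊗ₜ[k] g2 i →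
      Coalgebra.comul (R := k) h = ∑ j, h1 j ⊗ₜ[k] h2 j →
      mσ (g ⊗ₜ[k] h) = ∑ i, ∑ j, σ (g2 i ⊗ₜ[k] h2 j) • (g1 i * h1 j))
    (hX : ∀ h : B, σ ((1 : B) ⊗ₜ[k] h) = Coalgebra.counit (R := k) h) (a : B) :
    mσ (1 ⊗ₜ[k] a) = a := by
  refine comat_induction (k := k) a (fun n1 t1 h1 i j => ?_) ?_ ?_ ?_
  · rw [hmσ _ _ 1 _ (fun _ => 1) (fun _ => 1) _ _ (by simp [Algebra.TensorProduct.one_def])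
      (h1.comul i j)]
    simp [hX, h1.counit]
  · intro x y hx hy; simp only [TensorProduct.tmul_add, map_add, hx, hy]
  · intro s x hx; simp only [TensorProduct.tmul_smul, map_smul, hx]
  · simp

lemma comul_mτ
    (τ : C ⊗[k] C →ₗ[k] k) (mτ : C ⊗[k] C →ₗ[k] C)
    (hmτ : ∀ (g h : C) (n m : ℕ) (g1 g2 : Fin n → C) (h1 h2 : Fin m → C),
      Coalgebra.comul (R := k) g = ∑ i, g1 i ⊗ₜ[k] g2 i →
      Coalgebra.comul (R := k) h = ∑ j, h1 j ⊗ₜ[k] h2 j →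
      mτ (g ⊗ₜ[k] h) = ∑ i, ∑ j, τ (g1 i ⊗ₜ[k] h1 j) • (g2 i * h2 j))
    {n1 n2 : ℕ} {t1 : Fin n1 → Fin n1 → C} {t2 : Fin n2 → Fin n2 → C}
    (h1 : IsComat k t1) (h2 : IsComat k t2) (i j : Fin n1) (κ l : Fin n2) :
    Coalgebra.comul (R := k) (mτ (t1 i j ⊗ₜ[k] t2 κ l))
      = ∑ x, ∑ y, mτ (t1 i x ⊗ₜ[k] t2 κ y) ⊗ₜ[k] (t1 x j * t2 y l) := by
  simp only [hmτ _ _ _ _ _ _ _ _ (h1.comul _ _) (h2.comul _ _), map_sum, map_smul,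
    comul_comat_mul h1 h2, TensorProduct.tmul_sum, TensorProduct.sum_tmul, Finset.smul_sum,
    TensorProduct.tmul_smul, ← TensorProduct.smul_tmul']
  simp only [← Fintype.sum_prod_type']
  refine Fintype.sum_equiv ⟨fun ⟨x, y, u, v⟩ => (u, v, x, y),
    fun ⟨u, v, x, y⟩ => (x, y, u, v), fun _ => rfl, fun _ => rfl⟩ _ _ ?_
  rintro ⟨x, y, u, v⟩
  rfl

lemma assoc_mτ
    (τ : C ⊗[k] C →ₗ[k] k) (mτ : C ⊗[k] C →ₗ[k] C)
    (hmτ : ∀ (g h : C) (n m : ℕ) (g1 g2 : Fin n → C) (h1 h2 : Fin m → C),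
      Coalgebra.comul (R := k) g = ∑ i, g1 i ⊗ₜ[k] g2 i →
      Coalgebra.comul (R := k) h = ∑ j, h1 j ⊗ₜ[k] h2 j →
      mτ (g ⊗ₜ[k] h) = ∑ i, ∑ j, τ (g1 i ⊗ₜ[k] h1 j) • (g2 i * h2 j))
    (hco : ∀ (h g l : C) (m p : ℕ) (g1 g2 : Fin m → C) (l1 l2 : Fin p → C),
      Coalgebra.comul (R := k) g = ∑ j, g1 j ⊗ₜ[k] g2 j →
      Coalgebra.comul (R := k) l = ∑ s, l1 s ⊗ₜ[k] l2 s →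
      ∀ (n : ℕ) (h1 h2 : Fin n → C),
      Coalgebra.comul (R := k) h = ∑ i, h1 i ⊗ₜ[k] h2 i →
      ∑ j, ∑ s, τ (h ⊗ₜ[k] (g2 j * l2 s)) * τ (g1 j ⊗ₜ[k] l1 s)
        = ∑ i, ∑ j, τ ((h2 i * g2 j) ⊗ₜ[k] l) * τ (h1 i ⊗ₜ[k] g1 j))
    (a b c : C) :
    mτ (mτ (a ⊗ₜ[k] b) ⊗ₜ[k] c) = mτ (a ⊗ₜ[k] mτ (b ⊗ₜ[k] c)) := by
  refine comat_induction (k := k) a (fun n1 t1 h1 i j => ?_) ?_ ?_ ?_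
  rotate_left
  · intro x y hx hy; simp only [TensorProduct.add_tmul, map_add, hx, hy]
  · intro s x hx; simp only [← TensorProduct.smul_tmul', map_smul, hx]
  · simp
  refine comat_induction (k := k) b (fun n2 t2 h2 κ l => ?_) ?_ ?_ ?_
  rotate_left
  · intro x y hx hy; simp only [TensorProduct.add_tmul, TensorProduct.tmul_add, map_add, hx, hy]
  · intro s x hx
    simp only [← TensorProduct.smul_tmul', TensorProduct.tmul_smul, map_smul, hx]
  · simp
  refine comat_induction (k := k) c (fun n3 t3 h3 p q => ?_) ?_ ?_ ?_
  rotate_left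
  · intro x y hx hy; simp only [TensorProduct.tmul_add, map_add, hx, hy]
  · intro s x hx; simp only [TensorProduct.tmul_smul, map_smul, hx]
  · simp
  have e1 : ∀ x y x' y', mτ ((t1 x x' * t2 y y') ⊗ₜ[k] t3 p q) = _ := fun x y x' y' =>
    reindex2 _ _ (fun g1 g2 h1 h2 => τ (g1 ⊗ₜ[k] h1) • (g2 * h2)) _
      (hmτ (t1 x x' * t2 y y') (t3 p q)) _ _
      (comul_comat_mul' h1 h2 x x' y y') (h3.comul p q)
  have e2 : ∀ x y x' y', mτ (t1 i j ⊗ₜ[k] (t2 x x' * t3 y y')) = _ := fun x y x' y' =>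
    reindex2 _ _ (fun g1 g2 h1 h2 => τ (g1 ⊗ₜ[k] h1) • (g2 * h2)) _
      (hmτ (t1 i j) (t2 x x' * t3 y y')) _ _
      (h1.comul i j) (comul_comat_mul' h2 h3 x x' y y')
  have hL : mτ (mτ (t1 i j ⊗ₜ[k] t2 κ l) ⊗ₜ[k] t3 p q) = ∑ u, ∑ v, ∑ r,
      (∑ x, ∑ y, τ ((t1 x u * t2 y v) ⊗ₜ[k] t3 p r) * τ (t1 i x ⊗ₜ[k] t2 κ y)) • (t1 u j * t2 v l * t3 r q) := by
    rw [hmτ _ _ _ _ _ _ _ _ (h1.comul i j) (h2.comul κ l)]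
    simp only [TensorProduct.sum_tmul, ← TensorProduct.smul_tmul', map_sum, map_smul, e1]
    simp only [Finset.sum_smul, Finset.smul_sum]
    simp only [smul_smul, ← Fintype.sum_prod_type']
    refine Fintype.sum_equiv ⟨fun ⟨x, y, ⟨u, v⟩, r⟩ => (u, v, r, x, y),
      fun ⟨u, v, r, x, y⟩ => (x, y, (u, v), r), fun _ => rfl, fun _ => rfl⟩ _ _ ?_
    rintro ⟨x, y, ⟨u, v⟩, r⟩
    dsimp only [Equiv.coe_fn_mk]
    congr 1
    ring
  rw [hL, hmτ _ _ _ _ _ _ _ _ (h2.comul κ l) (h3.comul p q)]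
  have hc := fun u v r => hco (t1 i u) (t2 κ v) (t3 p r) _ _ _ _ _ _ (h2.comul _ _) (h3.comul _ _) _ _ _ (h1.comul _ _)
  simp only [← hc, TensorProduct.tmul_sum, TensorProduct.tmul_smul, map_sum, map_smul, e2]
  simp only [Finset.sum_smul, Finset.smul_sum]
  simp only [smul_smul, ← Fintype.sum_prod_type', mul_assoc]
  refine Fintype.sum_equiv ⟨fun ⟨u, v, r, x, y⟩ => (x, y, u, (v, r)),
    fun ⟨x, y, u, (v, r)⟩ => (u, v, r, x, y), fun _ => rfl, fun _ => rfl⟩ _ _ ?_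
  rintro ⟨u, v, r, x, y⟩
  dsimp only [Equiv.coe_fn_mk]
  congr 1
  ring

lemma mτ_one
    (τ : C ⊗[k] C →ₗ[k] k) (mτ : C ⊗[k] C →ₗ[k] C)
    (hmτ : ∀ (g h : C) (n m : ℕ) (g1 g2 : Fin n → C) (h1 h2 : Fin m → C),
      Coalgebra.comul (R := k) g = ∑ i, g1 i ⊗ₜ[k] g2 i →
      Coalgebra.comul (R := k) h = ∑ j, h1 j ⊗ₜ[k] h2 j →
      mτ (g ⊗ₜ[k] h) = ∑ i, ∑ j, τ (g1 i ⊗ₜ[k] h1 j) • (g2 i * h2 j))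
    (hX : ∀ h : C, τ (h ⊗ₜ[k] (1 : C)) = Coalgebra.counit (R := k) h) (a : C) :
    mτ (a ⊗ₜ[k] 1) = a := by
  refine comat_induction (k := k) a (fun n1 t1 h1 i j => ?_) ?_ ?_ ?_
  · rw [hmτ _ _ _ 1 _ _ (fun _ => 1) (fun _ => 1) (h1.comul i j)
      (by simp [Algebra.TensorProduct.one_def])]
    simp [hX, h1.counit]
  · intro x y hx hy; simp only [TensorProduct.add_tmul, map_add, hx, hy]
  · intro s x hx; simp only [← TensorProduct.smul_tmul', map_smul, hx]
  · simp

lemma one_mτ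
    (τ : C ⊗[k] C →ₗ[k] k) (mτ : C ⊗[k] C →ₗ[k] C)
    (hmτ : ∀ (g h : C) (n m : ℕ) (g1 g2 : Fin n → C) (h1 h2 : Fin m → C),
      Coalgebra.comul (R := k) g = ∑ i, g1 i ⊗ₜ[k] g2 i →
      Coalgebra.comul (R := k) h = ∑ j, h1 j ⊗ₜ[k] h2 j →
      mτ (g ⊗ₜ[k] h) = ∑ i, ∑ j, τ (g1 i ⊗ₜ[k] h1 j) • (g2 i * h2 j))
    (hX : ∀ h : C, τ ((1 : C) ⊗ₜ[k] h) = Coalgebra.counit (R := k) h) (a : C) :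
    mτ (1 ⊗ₜ[k] a) = a := by
  refine comat_induction (k := k) a (fun n1 t1 h1 i j => ?_) ?_ ?_ ?_
  · rw [hmτ _ _ 1 _ (fun _ => 1) (fun _ => 1) _ _ (by simp [Algebra.TensorProduct.one_def])
      (h1.comul i j)]
    simp [hX, h1.counit]
  · intro x y hx hy; simp only [TensorProduct.tmul_add, map_add, hx, hy]
  · intro s x hx; simp only [TensorProduct.tmul_smul, map_smul, hx]
  · simp

end

section
variable {k B C : Type} [Field k] [Ring B] [HopfAlgebra k B] [Ring C] [HopfAlgebra k C]

lemma explG_add_left (ev : C →ₗ[k] B →ₗ[k] k) (mσ : B ⊗[k] B →ₗ[k] B) (mτ : C ⊗[k] C →ₗ[k] C)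
    (b1 b2 : B) (c : C) :
    explG ev mσ mτ (b1 + b2) c = explG ev mσ mτ b1 c + explG ev mσ mτ b2 c := by
  simp only [explG, map_add, LinearMap.comp_add, LinearMap.add_comp, TensorProduct.map_add_left,
    TensorProduct.map_add_right]

lemma explG_add_right (ev : C →ₗ[k] B →ₗ[k] k) (mσ : B ⊗[k] B →ₗ[k] B) (mτ : C ⊗[k] C →ₗ[k] C)
    (b : B) (c1 c2 : C) :
    explG ev mσ mτ b (c1 + c2) = explG ev mσ mτ b c1 + explG ev mσ mτ b c2 := by
  simp only [explG, map_add, LinearMap.comp_add, LinearMap.add_comp, TensorProduct.map_add_left,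
    TensorProduct.map_add_right]

lemma explG_smul_left (ev : C →ₗ[k] B →ₗ[k] k) (mσ : B ⊗[k] B →ₗ[k] B) (mτ : C ⊗[k] C →ₗ[k] C)
    (s : k) (b : B) (c : C) :
    explG ev mσ mτ (s • b) c = s • explG ev mσ mτ b c := by
  simp only [explG, map_smul, LinearMap.comp_smul, LinearMap.smul_comp,
    TensorProduct.map_smul_left, TensorProduct.map_smul_right]

lemma explG_smul_right (ev : C →ₗ[k] B →ₗ[k] k) (mσ : B ⊗[k] B →ₗ[k] B)
    (mτ : C ⊗[k] C →ₗ[k] C) (s : k) (b : B) (c : C) :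
    explG ev mσ mτ b (s • c) = s • explG ev mσ mτ b c := by
  simp only [explG, map_smul, LinearMap.comp_smul, LinearMap.smul_comp,
    TensorProduct.map_smul_left, TensorProduct.map_smul_right]

end

theorem twist_of_drinfeld_double_product
    (ev : C →ₗ[k] B →ₗ[k] k) (hev : IsWeakHopfPairing ev)
    (mD : (B ⊗[k] C) ⊗[k] (B ⊗[k] C) →ₗ[k] B ⊗[k] C) (hmD : IsDrinMul ev mD)
    -- `σ` is a right 2-cocycle on `B`
    (σ σinv : B ⊗[k] B →ₗ[k] k)
    (hσconv : ∀ (a b : B) (n m : ℕ) (a1 a2 : Fin n → B) (b1 b2 : Fin m → B),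
      Coalgebra.comul (R := k) a = ∑ i, a1 i ⊗ₜ[k] a2 i →
      Coalgebra.comul (R := k) b = ∑ j, b1 j ⊗ₜ[k] b2 j →
      (∑ i, ∑ j, σ (a1 i ⊗ₜ[k] b1 j) * σinv (a2 i ⊗ₜ[k] b2 j)
          = Coalgebra.counit (R := k) a * Coalgebra.counit (R := k) b) ∧
      (∑ i, ∑ j, σinv (a1 i ⊗ₜ[k] b1 j) * σ (a2 i ⊗ₜ[k] b2 j)
          = Coalgebra.counit (R := k) a * Coalgebra.counit (R := k) b))
    (hσcocycle : ∀ (h g l : B) (m p : ℕ) (g1 g2 : Fin m → B) (l1 l2 : Fin p → B),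
      Coalgebra.comul (R := k) g = ∑ j, g1 j ⊗ₜ[k] g2 j →
      Coalgebra.comul (R := k) l = ∑ s, l1 s ⊗ₜ[k] l2 s →
      ∀ (n : ℕ) (h1 h2 : Fin n → B),
      Coalgebra.comul (R := k) h = ∑ i, h1 i ⊗ₜ[k] h2 i →
      ∑ j, ∑ s, σ (h ⊗ₜ[k] (g1 j * l1 s)) * σ (g2 j ⊗ₜ[k] l2 s)
        = ∑ i, ∑ j, σ ((h1 i * g1 j) ⊗ₜ[k] l) * σ (h2 i ⊗ₜ[k] g2 j))
    (hσ1 : ∀ h : B, σ (h ⊗ₜ[k] (1 : B)) = Coalgebra.counit (R := k) h)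
    (hσ1' : ∀ h : B, σ ((1 : B) ⊗ₜ[k] h) = Coalgebra.counit (R := k) h)
    -- `τ` is a left 2-cocycle on `C`
    (τ τinv : C ⊗[k] C →ₗ[k] k)
    (hτconv : ∀ (a b : C) (n m : ℕ) (a1 a2 : Fin n → C) (b1 b2 : Fin m → C),
      Coalgebra.comul (R := k) a = ∑ i, a1 i ⊗ₜ[k] a2 i →
      Coalgebra.comul (R := k) b = ∑ j, b1 j ⊗ₜ[k] b2 j →
      (∑ i, ∑ j, τ (a1 i ⊗ₜ[k] b1 j) * τinv (a2 i ⊗ₜ[k] b2 j)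
          = Coalgebra.counit (R := k) a * Coalgebra.counit (R := k) b) ∧
      (∑ i, ∑ j, τinv (a1 i ⊗ₜ[k] b1 j) * τ (a2 i ⊗ₜ[k] b2 j)
          = Coalgebra.counit (R := k) a * Coalgebra.counit (R := k) b))
    (hτcocycle : ∀ (h g l : C) (m p : ℕ) (g1 g2 : Fin m → C) (l1 l2 : Fin p → C),
      Coalgebra.comul (R := k) g = ∑ j, g1 j ⊗ₜ[k] g2 j →
      Coalgebra.comul (R := k) l = ∑ s, l1 s ⊗ₜ[k] l2 s →
      ∀ (n : ℕ) (h1 h2 : Fin n → C),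
      Coalgebra.comul (R := k) h = ∑ i, h1 i ⊗ₜ[k] h2 i →
      ∑ j, ∑ s, τ (h ⊗ₜ[k] (g2 j * l2 s)) * τ (g1 j ⊗ₜ[k] l1 s)
        = ∑ i, ∑ j, τ ((h2 i * g2 j) ⊗ₜ[k] l) * τ (h1 i ⊗ₜ[k] g1 j))
    (hτ1 : ∀ c : C, τ (c ⊗ₜ[k] (1 : C)) = Coalgebra.counit (R := k) c)
    (hτ1' : ∀ c : C, τ ((1 : C) ⊗ₜ[k] c) = Coalgebra.counit (R := k) c)
    -- the 2-cocycle `σ ∘ τ` on the double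
    (st : (B ⊗[k] C) ⊗[k] (B ⊗[k] C) →ₗ[k] k)
    (hst : ∀ (b : B) (c : C) (b' : B) (c' : C)
        (n : ℕ) (p1 p2 : Fin n → B) (m : ℕ) (r1 r2 : Fin m → C),
      Coalgebra.comul (R := k) b' = ∑ i, p1 i ⊗ₜ[k] p2 i →
      Coalgebra.comul (R := k) c = ∑ j, r1 j ⊗ₜ[k] r2 j →
      st ((b ⊗ₜ[k] c) ⊗ₜ[k] (b' ⊗ₜ[k] c'))
        = ∑ i, ∑ j, σ (b ⊗ₜ[k] p2 i) * τ (r1 j ⊗ₜ[k] c') * ev (r2 j) (p1 i))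
    -- `mT` is the right twist `x ·_{σ∘τ} y = x₍₁₎y₍₁₎ (σ∘τ)(x₍₂₎⊗y₍₂₎)` of the double product
    (mT : (B ⊗[k] C) ⊗[k] (B ⊗[k] C) →ₗ[k] B ⊗[k] C)
    (hmT : ∀ (x y : B ⊗[k] C) (n m : ℕ)
        (x1 x2 : Fin n → B ⊗[k] C) (y1 y2 : Fin m → B ⊗[k] C),
      DrinComul k B C x = ∑ i, x1 i ⊗ₜ[k] x2 i →
      DrinComul k B C y = ∑ j, y1 j ⊗ₜ[k] y2 j →
      mT (x ⊗ₜ[k] y) = ∑ i, ∑ j, st (x2 i ⊗ₜ[k] y2 j) • mD (x1 i ⊗ₜ[k] y1 j))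
    -- the twisted products `·σ` on `B` and `·τ` on `C`
    (mσ : B ⊗[k] B →ₗ[k] B)
    (hmσ : ∀ (g h : B) (n m : ℕ) (g1 g2 : Fin n → B) (h1 h2 : Fin m → B),
      Coalgebra.comul (R := k) g = ∑ i, g1 i ⊗ₜ[k] g2 i →
      Coalgebra.comul (R := k) h = ∑ j, h1 j ⊗ₜ[k] h2 j →
      mσ (g ⊗ₜ[k] h) = ∑ i, ∑ j, σ (g2 i ⊗ₜ[k] h2 j) • (g1 i * h1 j))
    (mτ : C ⊗[k] C →ₗ[k] C)
    (hmτ : ∀ (g h : C) (n m : ℕ) (g1 g2 : Fin n → C) (h1 h2 : Fin m → C),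
      Coalgebra.comul (R := k) g = ∑ i, g1 i ⊗ₜ[k] g2 i →
      Coalgebra.comul (R := k) h = ∑ j, h1 j ⊗ₜ[k] h2 j →
      mτ (g ⊗ₜ[k] h) = ∑ i, ∑ j, τ (g1 i ⊗ₜ[k] h1 j) • (g2 i * h2 j)) :
    -- the twisted product is given by the explicit formula
    (∀ (b : B) (c : C) (b' : B) (c' : C)
        (n : ℕ) (p1 p2 : Fin n → B) (m : ℕ) (r1 r2 : Fin m → C),
      Coalgebra.comul (R := k) b' = ∑ i, p1 i ⊗ₜ[k] p2 i →
      Coalgebra.comul (R := k) c = ∑ j, r1 j ⊗ₜ[k] r2 j →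
      mT ((b ⊗ₜ[k] c) ⊗ₜ[k] (b' ⊗ₜ[k] c'))
        = ∑ i, ∑ j, ev (r2 j) (p1 i) • (mσ (b ⊗ₜ[k] p2 i) ⊗ₜ[k] mτ (r1 j ⊗ₜ[k] c'))) ∧
    -- it is associative with unit `1 ⊗ 1`
    (∀ x y z : B ⊗[k] C, mT (mT (x ⊗ₜ[k] y) ⊗ₜ[k] z) = mT (x ⊗ₜ[k] mT (y ⊗ₜ[k] z))) ∧
    (∀ x : B ⊗[k] C, mT (((1 : B) ⊗ₜ[k] (1 : C)) ⊗ₜ[k] x) = x) ∧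
    (∀ x : B ⊗[k] C, mT (x ⊗ₜ[k] ((1 : B) ⊗ₜ[k] (1 : C))) = x) := by
  have key : ∀ (b : B) (c : C) (b' : B) (c' : C), mT ((b ⊗ₜ[k] c) ⊗ₜ[k] (b' ⊗ₜ[k] c'))
      = explG ev mσ mτ b c'
        (Coalgebra.comul (R := k) b' ⊗ₜ[k] Coalgebra.comul (R := k) c) := by
    intro b c b' c'
    refine comat_induction (k := k) b (fun n1 β hβ i j => ?_) ?_ ?_ ?_
    rotate_left
    · intro x y hx hy
      simp only [TensorProduct.add_tmul, map_add, hx, hy, explG_add_left, LinearMap.add_apply]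
    · intro a x hx
      simp only [← TensorProduct.smul_tmul', map_smul, hx, explG_smul_left, LinearMap.smul_apply]
    · have h := explG_smul_left ev mσ mτ 0 0 c'
      simp only [zero_smul] at h
      simp [h]
    refine comat_induction (k := k) c' (fun m2 γ' hγ' r s => ?_) ?_ ?_ ?_
    rotate_left
    · intro x y hx hy
      simp only [TensorProduct.tmul_add, map_add, hx, hy, explG_add_right, LinearMap.add_apply]
    · intro a x hx
      simp only [TensorProduct.tmul_smul, map_smul, hx, explG_smul_right, LinearMap.smul_apply]
    · have h := explG_smul_right ev mσ mτ 0 (β i j) 0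
      simp only [zero_smul] at h
      simp [h]
    refine comat_induction (k := k) c (fun m1 γ hγ κ l => ?_) ?_ ?_ ?_
    rotate_left
    · intro x y hx hy
      simp only [TensorProduct.tmul_add, TensorProduct.add_tmul, map_add, hx, hy]
    · intro a x hx
      simp only [TensorProduct.tmul_smul, ← TensorProduct.smul_tmul', map_smul, hx]
    · simp
    refine comat_induction (k := k) b' (fun n2 β' hβ' p q => ?_) ?_ ?_ ?_
    rotate_left
    · intro x y hx hy
      simp only [TensorProduct.tmul_add, TensorProduct.add_tmul, map_add, hx, hy]
    · intro a x hx
      simp only [TensorProduct.tmul_smul, ← TensorProduct.smul_tmul', map_smul, hx]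
    · simp
    rw [formula_comat ev hev mD hmD σ τ st hst mT hmT mσ hmσ mτ hmτ hβ hγ hβ' hγ',
      hβ'.comul, hγ.comul]
    simp only [TensorProduct.sum_tmul, TensorProduct.tmul_sum, map_sum, explG_tmul]
    try rw [Finset.sum_comm]
  obtain ⟨hev1, hev2, hev3, hev4, -⟩ := hev
  have aσ := assoc_mσ σ mσ hmσ hσcocycle
  have aτ := assoc_mτ τ mτ hmτ hτcocycle
  refine ⟨?_, ?_, ?_, ?_⟩
  · intro b c b' c' n p1 p2 m r1 r2 hb hc
    rw [key, hb, hc]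
    simp only [TensorProduct.sum_tmul, TensorProduct.tmul_sum, map_sum, explG_tmul]
    try rw [Finset.sum_comm]
  · intro x y z
    induction x using TensorProduct.induction_on with
    | zero => simp
    | add x x' h h' => simp only [TensorProduct.add_tmul, map_add, h, h']
    | tmul b c =>
    induction y using TensorProduct.induction_on with
    | zero => simp
    | add x x' h h' => simp only [TensorProduct.add_tmul, TensorProduct.tmul_add, map_add, h, h']
    | tmul b' c' =>
    induction z using TensorProduct.induction_on with
    | zero => simp
    | add x x' h h' => simp only [TensorProduct.tmul_add, map_add, h, h']
    | tmul b'' c'' =>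
    refine comat_induction (k := k) c (fun m1 γ hγ i j => ?_) ?_ ?_ ?_
    rotate_left
    · intro x y hx hy
      simp only [TensorProduct.tmul_add, TensorProduct.add_tmul, map_add, hx, hy]
    · intro a x hx
      simp only [TensorProduct.tmul_smul, ← TensorProduct.smul_tmul', map_smul, hx]
    · simp
    refine comat_induction (k := k) b' (fun n2 β' hβ' κ l => ?_) ?_ ?_ ?_
    rotate_left
    · intro x y hx hy
      simp only [TensorProduct.tmul_add, TensorProduct.add_tmul, map_add, hx, hy]
    · intro a x hx
      simp only [TensorProduct.tmul_smul, ← TensorProduct.smul_tmul', map_smul, hx]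
    · simp
    refine comat_induction (k := k) c' (fun m2 γ' hγ' m n => ?_) ?_ ?_ ?_
    rotate_left
    · intro x y hx hy
      simp only [TensorProduct.tmul_add, TensorProduct.add_tmul, map_add, hx, hy]
    · intro a x hx
      simp only [TensorProduct.tmul_smul, ← TensorProduct.smul_tmul', map_smul, hx]
    · simp
    refine comat_induction (k := k) b'' (fun n3 β'' hβ'' p q => ?_) ?_ ?_ ?_
    rotate_left
    · intro x y hx hy
      simp only [TensorProduct.tmul_add, TensorProduct.add_tmul, map_add, hx, hy]
    · intro a x hx
      simp only [TensorProduct.tmul_smul, ← TensorProduct.smul_tmul', map_smul, hx]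
    · simp
    have k1 : mT ((b ⊗ₜ[k] γ i j) ⊗ₜ[k] (β' κ l ⊗ₜ[k] γ' m n)) = ∑ x, ∑ y,
        ev (γ y j) (β' κ x) • (mσ (b ⊗ₜ[k] β' x l) ⊗ₜ[k] mτ (γ i y ⊗ₜ[k] γ' m n)) := by
      rw [key, hβ'.comul, hγ.comul]
      simp only [TensorProduct.sum_tmul, TensorProduct.tmul_sum, map_sum, explG_tmul]
      try rw [Finset.sum_comm]
    have k2 : mT ((β' κ l ⊗ₜ[k] γ' m n) ⊗ₜ[k] (β'' p q ⊗ₜ[k] c'')) = ∑ w, ∑ v,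
        ev (γ' v n) (β'' p w) • (mσ (β' κ l ⊗ₜ[k] β'' w q) ⊗ₜ[k] mτ (γ' m v ⊗ₜ[k] c'')) := by
      rw [key, hβ''.comul, hγ'.comul]
      simp only [TensorProduct.sum_tmul, TensorProduct.tmul_sum, map_sum, explG_tmul]
      try rw [Finset.sum_comm]
    have k3 : ∀ x y, mT ((mσ (b ⊗ₜ[k] β' x l) ⊗ₜ[k] mτ (γ i y ⊗ₜ[k] γ' m n)) ⊗ₜ[k]
        (β'' p q ⊗ₜ[k] c'')) = ∑ u, ∑ v, ∑ z, ∑ w,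
        (ev (γ u y) (β'' w z) * ev (γ' v n) (β'' p w)) •
          (mσ (mσ (b ⊗ₜ[k] β' x l) ⊗ₜ[k] β'' z q) ⊗ₜ[k]
            mτ (mτ (γ i u ⊗ₜ[k] γ' m v) ⊗ₜ[k] c'')) := by
      intro x y
      rw [key, hβ''.comul, comul_mτ τ mτ hmτ hγ hγ']
      simp only [TensorProduct.tmul_sum, map_sum]
      refine Finset.sum_congr rfl fun u _ => Finset.sum_congr rfl fun v _ => ?_
      simp only [TensorProduct.sum_tmul, map_sum, explG_tmul]
      refine Finset.sum_congr rfl fun z _ => ?_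
      rw [hev1 _ _ _ _ _ _ (hβ''.comul p z), Finset.sum_smul]
    have k4 : ∀ w v, mT ((b ⊗ₜ[k] γ i j) ⊗ₜ[k]
        (mσ (β' κ l ⊗ₜ[k] β'' w q) ⊗ₜ[k] mτ (γ' m v ⊗ₜ[k] c''))) = ∑ u, ∑ x, ∑ z, ∑ y,
        (ev (γ u y) (β'' w z) * ev (γ y j) (β' κ x)) •
          (mσ (b ⊗ₜ[k] mσ (β' x l ⊗ₜ[k] β'' z q)) ⊗ₜ[k]
            mτ (γ i u ⊗ₜ[k] mτ (γ' m v ⊗ₜ[k] c''))) := by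
      intro w v
      rw [key, hγ.comul, comul_mσ σ mσ hmσ hβ' hβ'']
      simp only [TensorProduct.tmul_sum, map_sum]
      refine Finset.sum_congr rfl fun u _ => ?_
      simp only [TensorProduct.sum_tmul, map_sum, explG_tmul]
      refine Finset.sum_congr rfl fun x _ => Finset.sum_congr rfl fun z _ => ?_
      rw [hev2 _ _ _ _ _ _ (hγ.comul u j), Finset.sum_smul]
    rw [k1, k2]
    simp only [TensorProduct.sum_tmul, TensorProduct.tmul_sum, ← TensorProduct.smul_tmul',
      TensorProduct.tmul_smul (M := B ⊗[k] C) (N := B ⊗[k] C), map_sum, map_smul, k3, k4, aσ, aτ]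
    simp only [Finset.smul_sum]
    simp only [smul_smul, ← Fintype.sum_prod_type']
    refine Fintype.sum_equiv ⟨fun ⟨x, y, u, v, z, w⟩ => (w, v, u, x, z, y),
      fun ⟨w, v, u, x, z, y⟩ => (x, y, u, v, z, w), fun _ => rfl, fun _ => rfl⟩ _ _ ?_
    rintro ⟨x, y, u, v, z, w⟩
    dsimp only [Equiv.coe_fn_mk]
    congr 1
    ring
  · intro x
    induction x using TensorProduct.induction_on with
    | zero => simp
    | add x x' h h' => simp only [TensorProduct.tmul_add, map_add, h, h']
    | tmul b c =>
    refine comat_induction (k := k) b (fun n1 β hβ i j => ?_) ?_ ?_ ?_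
    · rw [key, Bialgebra.comul_one, Algebra.TensorProduct.one_def, hβ.comul]
      simp only [TensorProduct.sum_tmul, map_sum, explG_tmul, hev3, hβ.counit,
        one_mσ σ mσ hmσ hσ1', one_mτ τ mτ hmτ hτ1']
      simp
    · intro x y hx hy
      simp only [TensorProduct.tmul_add, TensorProduct.add_tmul, map_add, hx, hy]
    · intro a x hx
      simp only [TensorProduct.tmul_smul, ← TensorProduct.smul_tmul', map_smul, hx]
    · simp
  · intro x
    induction x using TensorProduct.induction_on with
    | zero => simp
    | add x x' h h' => simp only [TensorProduct.add_tmul, map_add, h, h']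
    | tmul b c =>
    refine comat_induction (k := k) c (fun m1 γ hγ i j => ?_) ?_ ?_ ?_
    · rw [key, Bialgebra.comul_one, Algebra.TensorProduct.one_def, hγ.comul]
      simp only [TensorProduct.tmul_sum, map_sum, explG_tmul, hev4, hγ.counit,
        mσ_one σ mσ hmσ hσ1, mτ_one τ mτ hmτ hτ1]
      simp
    · intro x y hx hy
      simp only [TensorProduct.tmul_add, TensorProduct.add_tmul, map_add, hx, hy]
    · intro a x hx
      simp only [TensorProduct.tmul_smul, ← TensorProduct.smul_tmul', map_smul, hx]
    · simp

end
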